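/- Let k and m be positive integers with m ≥ 2. If m = 2 then E_{4k+2} ≡ 4k(-48k^2 - 12k + 45) - 1 (mod 2^{9}), and if m ≥ 3 then E_{2^m k + 2} ≡ 2^m k(45 + 5·2^m k) - 1 (mod 2^{m+7}). -/

import Mathlib

/-- The Euler numbers `E n`, defined by `E 0 = 1`, `E (2n-1) = 0` for `n ≥ 1`,
and `∑_{r=0}^{n} C(2n, 2r) * E (2r) = 0` for `n ≥ 1`. -/
def eulerE : ℕ → ℤ
  | 0 => 1
  | 1 => 0
  | n + 2 =>
      if Even n then
        -∑ r ∈ (Finset.range (n / 2 + 1)).attach,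
          ((n + 2).choose (2 * r.1) : ℤ) * eulerE (2 * r.1)
      else 0
  decreasing_by
    have := r.2
    simp only [Finset.mem_range] at this
    omega

open Polynomial Finset

theorem eulerE_odd (n : ℕ) : eulerE (2 * n + 1) = 0 := by
  cases n with
  | zero => simp [eulerE]
  | succ n =>
    have h : ¬ Even (2 * n + 1) := by simp
    rw [show 2 * (n + 1) + 1 = (2 * n + 1) + 2 by ring, eulerE, if_neg h]

theorem sum_choose_mul_eulerE (n : ℕ) :
    ∑ r ∈ range (n + 2), ((2 * n + 2).choose (2 * r) : ℤ) * eulerE (2 * r) = 0 := by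
  have h : eulerE (2 * n + 2) =
      -∑ r ∈ range (n + 1), ((2 * n + 2).choose (2 * r) : ℤ) * eulerE (2 * r) := by
    rw [eulerE, if_pos (by simp), show 2 * n / 2 + 1 = n + 1 by omega,
      Finset.sum_attach (range (n + 1))
        (fun r => ((2 * n + 2).choose (2 * r) : ℤ) * eulerE (2 * r))]
  rw [sum_range_succ, show 2 * (n + 1) = 2 * n + 2 by ring, h]
  simp

/-- The linear functional on `ℤ[X]` whose moments are the Euler numbers. -/
noncomputable def eulerFunctional : ℤ[X] →ₗ[ℤ] ℤ :=
  Polynomial.lsum fun n => eulerE n • LinearMap.id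

theorem eulerFunctional_X_pow (n : ℕ) : eulerFunctional (X ^ n) = eulerE n := by
  simp [eulerFunctional, Polynomial.lsum_apply, X_pow_eq_monomial]

theorem sum_range_eq_sum_even {f : ℕ → ℤ} (hf : ∀ i, f (2 * i + 1) = 0) (n : ℕ) :
    ∑ i ∈ range (2 * n + 1), f i = ∑ r ∈ range (n + 1), f (2 * r) := by
  induction n with
  | zero => simp
  | succ n ih =>
    rw [sum_range_succ _ (n + 1), ← ih, show 2 * (n + 1) + 1 = 2 * n + 1 + 1 + 1 by ring,
      sum_range_succ, sum_range_succ, hf, add_zero]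
    rfl

theorem eulerFunctional_X_add_one_pow_add (n : ℕ) :
    eulerFunctional ((X + 1) ^ n + (X - 1) ^ n) = 2 * 0 ^ n := by
  have expand : eulerFunctional ((X + 1) ^ n + (X - 1) ^ n) =
      ∑ i ∈ range (n + 1), (1 + (-1) ^ (n - i)) * ((n.choose i : ℤ) * eulerE i) := by
    have h : ((X + 1) ^ n + (X - 1) ^ n : ℤ[X]) =
        ∑ i ∈ range (n + 1), ((1 + (-1) ^ (n - i)) * (n.choose i : ℤ)) • X ^ i := by
      rw [sub_eq_add_neg, add_pow, add_pow, ← sum_add_distrib]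
      refine sum_congr rfl fun i _ => ?_
      rw [zsmul_eq_mul]
      push_cast
      ring
    rw [h, map_sum]
    refine sum_congr rfl fun i _ => ?_
    rw [map_zsmul, eulerFunctional_X_pow, smul_eq_mul, mul_assoc]
  rw [expand]
  rcases Nat.even_or_odd' n with ⟨k, rfl | rfl⟩
  · rw [sum_range_eq_sum_even (fun i => by simp [eulerE_odd])]
    have h : ∀ r ∈ range (k + 1),
        (1 + (-1 : ℤ) ^ (2 * k - 2 * r)) * (((2 * k).choose (2 * r) : ℤ) * eulerE (2 * r)) =
        2 * (((2 * k).choose (2 * r) : ℤ) * eulerE (2 * r)) := fun r _ => by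
      rw [← Nat.mul_sub, pow_mul]
      norm_num
    rw [sum_congr rfl h, ← mul_sum]
    cases k with
    | zero => simp [eulerE]
    | succ k => simpa [mul_add] using sum_choose_mul_eulerE k
  · rw [sum_eq_zero fun i hi => ?_]
    · simp
    rcases Nat.even_or_odd' i with ⟨r, rfl | rfl⟩
    · have h : Odd (2 * k + 1 - 2 * r) := by
        rw [mem_range] at hi
        exact ⟨k - r, by omega⟩
      simp [h.neg_one_pow]
    · simp [eulerE_odd]

theorem eulerFunctional_comp_add_comp (p : ℤ[X]) :
    eulerFunctional (p.comp (X + 1) + p.comp (X - 1)) = 2 * p.eval 0 := by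
  induction p using Polynomial.induction_on' with
  | add p q hp hq =>
    rw [map_add] at hp hq ⊢
    simp only [add_comp, map_add, eval_add]
    linear_combination hp + hq
  | monomial n a =>
    have h := eulerFunctional_X_add_one_pow_add n
    rw [← mul_one a, ← smul_eq_mul, ← smul_monomial, ← X_pow_eq_monomial]
    simp only [smul_comp, X_pow_comp, ← smul_add, map_smul, h]
    simp
    ring

/-- The polynomial whose roots are the odd integers `±1, ±3, …, ±(2j-1)`. -/
noncomputable def oddRootsPoly (j : ℕ) : ℤ[X] :=
  ∏ i ∈ range j, (X ^ 2 - (2 * (i : ℤ[X]) + 1) ^ 2)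

/-- The polynomial whose roots are the even integers `0, ±2, …, ±2j`. -/
noncomputable def evenRootsPoly (j : ℕ) : ℤ[X] :=
  X * ∏ i ∈ range j, (X ^ 2 - (2 * (i : ℤ[X]) + 2) ^ 2)

theorem oddRootsPoly_succ (j : ℕ) :
    oddRootsPoly (j + 1) = oddRootsPoly j * (X ^ 2 - (2 * (j : ℤ[X]) + 1) ^ 2) :=
  prod_range_succ _ _

theorem evenRootsPoly_succ (j : ℕ) :
    evenRootsPoly (j + 1) = evenRootsPoly j * (X ^ 2 - (2 * (j : ℤ[X]) + 2) ^ 2) := by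
  rw [evenRootsPoly, prod_range_succ, ← mul_assoc, evenRootsPoly]

theorem evenRootsPoly_comp_X_add_one (j : ℕ) :
    (evenRootsPoly j).comp (X + 1) = (X + (2 * (j : ℤ[X]) + 1)) * oddRootsPoly j := by
  induction j with
  | zero => simp [evenRootsPoly, oddRootsPoly]
  | succ j ih =>
    rw [evenRootsPoly_succ, oddRootsPoly_succ, mul_comp, ih]
    simp only [sub_comp, pow_comp, add_comp, mul_comp, X_comp, natCast_comp, ofNat_comp]
    push_cast
    ring

theorem evenRootsPoly_comp_X_sub_one (j : ℕ) :
    (evenRootsPoly j).comp (X - 1) = (X - (2 * (j : ℤ[X]) + 1)) * oddRootsPoly j := by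
  induction j with
  | zero => simp [evenRootsPoly, oddRootsPoly]
  | succ j ih =>
    rw [evenRootsPoly_succ, oddRootsPoly_succ, mul_comp, ih]
    simp only [sub_comp, pow_comp, add_comp, mul_comp, X_comp, natCast_comp, ofNat_comp]
    push_cast
    ring

theorem eulerFunctional_X_mul_oddRootsPoly (j : ℕ) :
    eulerFunctional (X * oddRootsPoly j) = 0 := by
  have h := eulerFunctional_comp_add_comp (evenRootsPoly j)
  have h2 : (X + (2 * (j : ℤ[X]) + 1)) * oddRootsPoly j +
      (X - (2 * (j : ℤ[X]) + 1)) * oddRootsPoly j = (2 : ℤ) • (X * oddRootsPoly j) := by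
    rw [zsmul_eq_mul]
    push_cast
    ring
  rw [evenRootsPoly_comp_X_add_one, evenRootsPoly_comp_X_sub_one, h2, map_zsmul] at h
  simpa [evenRootsPoly] using h

theorem eulerFunctional_oddRootsPoly_succ (j : ℕ) :
    eulerFunctional (oddRootsPoly (j + 1)) =
      -((2 * j + 1) * (2 * j + 2)) * eulerFunctional (oddRootsPoly j) := by
  have h := eulerFunctional_comp_add_comp ((X - (2 * (j : ℤ[X]) + 2)) * evenRootsPoly j)
  have h2 : ((X - (2 * (j : ℤ[X]) + 2)) * evenRootsPoly j).comp (X + 1) +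
      ((X - (2 * (j : ℤ[X]) + 2)) * evenRootsPoly j).comp (X - 1) =
      (2 : ℤ) • oddRootsPoly (j + 1) + (-(4 * j + 4) : ℤ) • (X * oddRootsPoly j) +
        ((2 * j + 1) * (4 * j + 4) : ℤ) • oddRootsPoly j := by
    rw [mul_comp, mul_comp, evenRootsPoly_comp_X_add_one, evenRootsPoly_comp_X_sub_one,
      oddRootsPoly_succ]
    simp only [sub_comp, add_comp, mul_comp, X_comp, natCast_comp, ofNat_comp, zsmul_eq_mul]
    push_cast
    ring
  rw [h2] at h
  simp only [map_add, map_zsmul, eulerFunctional_X_mul_oddRootsPoly, smul_eq_mul] at h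
  simp only [evenRootsPoly, eval_mul, eval_X, zero_mul, mul_zero] at h
  linarith

theorem eulerFunctional_oddRootsPoly (j : ℕ) :
    eulerFunctional (oddRootsPoly j) = (-1) ^ j * ((2 * j).factorial : ℤ) := by
  induction j with
  | zero => simpa [oddRootsPoly, eulerE] using eulerFunctional_X_pow 0
  | succ j ih =>
    rw [eulerFunctional_oddRootsPoly_succ, ih, show 2 * (j + 1) = 2 * j + 1 + 1 by ring,
      Nat.factorial_succ, Nat.factorial_succ]
    push_cast
    ring

theorem eulerFunctional_pow_succ_mul (i j : ℕ) :
    eulerFunctional ((X ^ 2 - 1) ^ (i + 1) * oddRootsPoly j) =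
      eulerFunctional ((X ^ 2 - 1) ^ i * oddRootsPoly (j + 1)) +
        4 * j * (j + 1) * eulerFunctional ((X ^ 2 - 1) ^ i * oddRootsPoly j) := by
  have h : (X ^ 2 - 1) ^ (i + 1) * oddRootsPoly j =
      (X ^ 2 - 1) ^ i * oddRootsPoly (j + 1) +
        (4 * j * (j + 1) : ℤ) • ((X ^ 2 - 1) ^ i * oddRootsPoly j) := by
    rw [oddRootsPoly_succ, zsmul_eq_mul]
    push_cast
    ring
  rw [h, map_add, map_zsmul, smul_eq_mul]

theorem two_pow_dvd_factorial_two_mul : ∀ j : ℕ, 2 ^ (j + j / 2) ∣ (2 * j).factorial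
  | 0 => by simp
  | 1 => by decide
  | j + 2 => by
    have ih := two_pow_dvd_factorial_two_mul j
    have h : 2 ^ 3 ∣ (2 * j + 4) * (2 * j + 2) := by
      rcases Nat.even_or_odd' j with ⟨r, rfl | rfl⟩
      · exact ⟨(r + 1) * (2 * r + 1), by ring⟩
      · exact ⟨(2 * r + 3) * (r + 1), by ring⟩
    rw [show j + 2 + (j + 2) / 2 = 3 + (j + j / 2) by omega, pow_add,
      show 2 * (j + 2) = 2 * j + 1 + 1 + 1 + 1 by ring]
    simp only [Nat.factorial_succ]
    obtain ⟨c, hc⟩ := mul_dvd_mul h ih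
    exact ⟨c * ((2 * j + 3) * (2 * j + 1)), by
      linear_combination (2 * j + 3) * (2 * j + 1) * hc⟩

theorem two_pow_dvd_eulerFunctional_pow_mul (i j : ℕ) :
    (2 : ℤ) ^ (i + j + (i + j) / 2) ∣
      eulerFunctional ((X ^ 2 - 1) ^ i * oddRootsPoly j) := by
  induction i generalizing j with
  | zero =>
    rw [pow_zero, one_mul, zero_add, eulerFunctional_oddRootsPoly]
    exact Dvd.dvd.mul_left (mod_cast two_pow_dvd_factorial_two_mul j) _
  | succ i ih =>
    rw [eulerFunctional_pow_succ_mul]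
    refine dvd_add ?_ ?_
    · rw [show i + 1 + j = i + (j + 1) by ring]
      exact ih (j + 1)
    · rw [mul_assoc 4]
      refine dvd_trans ?_ (mul_dvd_mul (dvd_mul_right 4 _) (ih j))
      rw [show (4 : ℤ) = 2 ^ 2 by norm_num, ← pow_add]
      exact pow_dvd_pow _ (by omega)

theorem two_pow_dvd_eulerFunctional_pow (i : ℕ) :
    (2 : ℤ) ^ (i + i / 2) ∣ eulerFunctional ((X ^ 2 - 1) ^ i) := by
  simpa [oddRootsPoly] using two_pow_dvd_eulerFunctional_pow_mul i 0

theorem eulerFunctional_pow_values :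
    eulerFunctional ((X ^ 2 - 1) ^ 0) = 1 ∧ eulerFunctional ((X ^ 2 - 1) ^ 1) = -2 ∧
    eulerFunctional ((X ^ 2 - 1) ^ 2) = 8 ∧ eulerFunctional ((X ^ 2 - 1) ^ 3) = -80 ∧
    eulerFunctional ((X ^ 2 - 1) ^ 4) = 1664 ∧ eulerFunctional ((X ^ 2 - 1) ^ 5) = -58112 ∧
    eulerFunctional ((X ^ 2 - 1) ^ 6) = 3027968 := by
  have h0 (j : ℕ) : eulerFunctional ((X ^ 2 - 1) ^ 0 * oddRootsPoly j) =
      (-1) ^ j * ((2 * j).factorial : ℤ) := by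
    rw [pow_zero, one_mul, eulerFunctional_oddRootsPoly]
  have h (i : ℕ) : eulerFunctional ((X ^ 2 - 1) ^ i) =
      eulerFunctional ((X ^ 2 - 1) ^ i * oddRootsPoly 0) := by
    simp [oddRootsPoly]
  have hs := eulerFunctional_pow_succ_mul
  refine ⟨?_, ?_, ?_, ?_, ?_, ?_, ?_⟩ <;> rw [h] <;>
    simp only [hs 0, hs 1, hs 2, hs 3, hs 4, hs 5, h0, Nat.factorial] <;> norm_num

theorem eulerE_two_mul_add_two_eq_sum (N : ℕ) :
    eulerE (2 * N + 2) = ∑ i ∈ range (6 + N), (N.choose i : ℤ) *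
      (eulerFunctional ((X ^ 2 - 1) ^ i) + eulerFunctional ((X ^ 2 - 1) ^ (i + 1))) := by
  have h : (X ^ (2 * N + 2) : ℤ[X]) = ∑ i ∈ range (N + 1),
      (N.choose i : ℤ) • ((X ^ 2 - 1) ^ i + (X ^ 2 - 1) ^ (i + 1)) := by
    calc (X ^ (2 * N + 2) : ℤ[X]) = ((X ^ 2 - 1) + 1) ^ N * X ^ 2 := by ring
      _ = _ := by
        rw [add_pow, sum_mul]
        refine sum_congr rfl fun i _ => ?_
        rw [zsmul_eq_mul]
        push_cast
        ring
  rw [← eulerFunctional_X_pow, h, map_sum]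
  simp only [map_zsmul, map_add, smul_eq_mul]
  refine sum_subset (range_subset_range.2 (by omega)) fun i _ hi => ?_
  rw [Nat.choose_eq_zero_of_lt (by simpa using hi)]
  simp

theorem two_pow_dvd_choose_mul {n N i : ℕ} (hN : 2 ^ n ∣ N) (hi : 6 ≤ i) {d : ℤ}
    (hd : (2 : ℤ) ^ (i + i / 2) ∣ d) : (2 : ℤ) ^ (n + 8) ∣ (N.choose i : ℤ) * d := by
  obtain ⟨a, b, hb, rfl⟩ := Nat.exists_eq_two_pow_mul_odd (n := i) (by omega)
  set i := 2 ^ a * b with hi_def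
  have hdvd : 2 ^ n ∣ i * N.choose i := by
    cases N with
    | zero => simp [Nat.choose_eq_zero_of_lt (show 0 < i by omega)]
    | succ N =>
      obtain ⟨l, hl⟩ : ∃ l, i = l + 1 := ⟨i - 1, by omega⟩
      rw [hl, _root_.mul_comm, ← Nat.add_one_mul_choose_eq]
      exact hN.mul_right _
  have hle : 2 ^ a ≤ i := Nat.le_mul_of_pos_right _ hb.pos
  have ha : a + 8 ≤ i + i / 2 := by
    have h2 : 2 * a ≤ 2 ^ a := by
      cases a with
      | zero => simp
      | succ a =>
        have := Nat.lt_two_pow_self (n := a)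
        rw [pow_succ]
        omega
    by_cases h8 : 8 ≤ i
    · omega
    · have : a < 3 := by
        by_contra! h
        have := Nat.pow_le_pow_right (n := 2) (by norm_num) h
        omega
      have : a = 2 → 4 * b = i := by
        rintro rfl
        rfl
      omega
  have hodd : IsCoprime ((2 : ℤ) ^ (n + 8)) (b : ℤ) := by
    refine IsCoprime.pow_left ?_
    rw [Int.isCoprime_iff_gcd_eq_one]
    exact_mod_cast Nat.coprime_two_left.2 hb
  have hmul : (2 : ℤ) ^ n * 2 ^ (a + 8) ∣ (i : ℤ) * N.choose i * d :=
    mul_dvd_mul (mod_cast hdvd) ((pow_dvd_pow _ ha).trans hd)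
  have hcancel : (2 : ℤ) ^ a * 2 ^ (n + 8) ∣ 2 ^ a * (b * (N.choose i * d)) := by
    convert hmul using 1
    · ring
    · rw [hi_def]
      push_cast
      ring
  exact hodd.dvd_of_dvd_mul_left ((mul_dvd_mul_iff_left (by positivity)).1 hcancel)

theorem natCast_choose_mul_factorial (N : ℕ) :
    (N.choose 2 : ℤ) * 2 = N * (N - 1) ∧ (N.choose 3 : ℤ) * 6 = N * (N - 1) * (N - 2) ∧
    (N.choose 4 : ℤ) * 24 = N * (N - 1) * (N - 2) * (N - 3) ∧
    (N.choose 5 : ℤ) * 120 = N * (N - 1) * (N - 2) * (N - 3) * (N - 4) := by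
  have h (i : ℕ) : (N.choose (i + 1) : ℤ) * (i + 1) = N.choose i * (N - i) := by
    rcases le_or_gt i N with hi | hi
    · rw [← Nat.cast_sub hi]
      exact_mod_cast Nat.choose_succ_right_eq N i
    · simp [Nat.choose_eq_zero_of_lt hi, Nat.choose_eq_zero_of_lt (hi.trans (Nat.lt_succ_self i))]
  have h1 := h 1
  have h2 := h 2
  have h3 := h 3
  have h4 := h 4
  norm_num at h1 h2 h3 h4
  refine ⟨h1, ?_, ?_, ?_⟩
  · linear_combination 2 * h2 + (N - 2 : ℤ) * h1
  · linear_combination 6 * h3 + (N - 3 : ℤ) * (2 * h2 + (N - 2 : ℤ) * h1)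
  · linear_combination 24 * h4 +
      (N - 4 : ℤ) * (6 * h3 + (N - 3 : ℤ) * (2 * h2 + (N - 2 : ℤ) * h1))

theorem five_mul_eulerE_two_mul_add_two_modEq {n N : ℕ} (hN : 2 ^ n ∣ N) :
    5 * eulerE (2 * N + 2) ≡ -5 + N * (5 * (6 - 36 * (N - 1) + 264 * (N - 1) * (N - 2) -
      2352 * (N - 1) * (N - 2) * (N - 3)) + 123744 * (N - 1) * (N - 2) * (N - 3) * (N - 4))
      [ZMOD 2 ^ (n + 8)] := by
  have htail : (2 : ℤ) ^ (n + 8) ∣ ∑ i ∈ range N, (N.choose (6 + i) : ℤ) *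
      (eulerFunctional ((X ^ 2 - 1) ^ (6 + i)) +
        eulerFunctional ((X ^ 2 - 1) ^ (6 + i + 1))) :=
    dvd_sum fun i _ => two_pow_dvd_choose_mul hN (by omega) <|
      dvd_add (two_pow_dvd_eulerFunctional_pow _) <|
        (pow_dvd_pow _ (by omega)).trans (two_pow_dvd_eulerFunctional_pow _)
  obtain ⟨v0, v1, v2, v3, v4, v5, v6⟩ := eulerFunctional_pow_values
  obtain ⟨c2, c3, c4, c5⟩ := natCast_choose_mul_factorial N
  rw [eulerE_two_mul_add_two_eq_sum, sum_range_add]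
  refine (Int.modEq_iff_dvd.2 ((dvd_mul_of_dvd_right htail (-5)).trans (dvd_of_eq ?_)))
  simp only [sum_range_succ, sum_range_zero, Nat.reduceAdd, v0, v1, v2, v3, v4, v5, v6,
    Nat.choose_zero_right, Nat.choose_one_right, Nat.cast_one]
  linear_combination -180 * c2 + 1320 * c3 - 11760 * c4 + 123744 * c5

theorem eulerE_two_mul_add_two_modEq {n N : ℕ} (hN : 2 ^ n ∣ N) {t : ℤ}
    (ht : (2 : ℤ) ^ 8 ∣ 5 * (6 - 36 * ((N : ℤ) - 1) + 264 * (N - 1) * (N - 2) -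
      2352 * (N - 1) * (N - 2) * (N - 3)) +
      123744 * (N - 1) * (N - 2) * (N - 3) * (N - 4) - 5 * t) :
    eulerE (2 * N + 2) ≡ N * t - 1 [ZMOD 2 ^ (n + 8)] := by
  have hcop : IsCoprime ((2 : ℤ) ^ (n + 8)) 5 :=
    IsCoprime.pow_left (by rw [Int.isCoprime_iff_gcd_eq_one]; rfl)
  have hNz : (2 : ℤ) ^ n ∣ N := mod_cast hN
  have h := (five_mul_eulerE_two_mul_add_two_modEq hN).symm.dvd
  have h2 := mul_dvd_mul hNz ht
  rw [← pow_add] at h2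
  refine (Int.modEq_iff_dvd.2 (hcop.dvd_of_dvd_mul_left ?_)).symm
  convert dvd_add h h2 using 1
  ring

theorem eulerE_two_pow_mul_add_two (k m : ℕ) (hk : 0 < k) (hm : 2 ≤ m) :
    (m = 2 → eulerE (4 * k + 2) ≡
        4 * k * (-48 * (k : ℤ) ^ 2 - 12 * k + 45) - 1 [ZMOD 2 ^ 9]) ∧
    (3 ≤ m → eulerE (2 ^ m * k + 2) ≡
        2 ^ m * (k : ℤ) * (45 + 5 * 2 ^ m * k) - 1 [ZMOD 2 ^ (m + 7)]) := by
  refine ⟨fun _ => ?_, fun hm3 => ?_⟩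
  · have h := eulerE_two_mul_add_two_modEq (n := 1) (N := 2 * k) (by simp)
      (t := 2 * (-48 * (k : ℤ) ^ 2 - 12 * k + 45)) ?_
    · convert h using 1
      · ring_nf
      · push_cast
        ring
    · obtain ⟨e, he⟩ := Int.even_mul_succ_self k
      refine ⟨11886 - 49380 * k + 107835 * k ^ 2 - 78075 * e * k + 7734 * k ^ 4, ?_⟩
      push_cast
      linear_combination -128 * 78075 * (k : ℤ) * he
  · obtain ⟨n, rfl⟩ : ∃ n, m = n + 3 := ⟨m - 3, by omega⟩
    have h := eulerE_two_mul_add_two_modEq (n := n + 2) (N := 4 * (2 ^ n * k))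
      ⟨k, by ring⟩ (t := 2 * (45 + 10 * (4 * (2 ^ n * k)))) ?_
    · convert h using 1
      · ring_nf
      · push_cast
        ring
    · obtain ⟨e, he⟩ := Int.even_mul_succ_self (2 ^ n * k)
      refine ⟨11886 + 550365 * e - 373945 * (2 ^ n * k) - 312300 * (2 ^ n * k) ^ 3 +
        123744 * (2 ^ n * k) ^ 4, ?_⟩
      push_cast
      linear_combination 128 * 550365 * he
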